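/- arXiv:1702.08814 — 2 statements merged into one kernel-verified Lean document; each statement's English description precedes it below -/
import Mathlib

section
/- For h₁, h₂ with 0 < h₂ ≤ h₁, let R = (0,h₁)×(0,h₂) and let b_R(x,y) = 16 (x/h₁)(1 − x/h₁)(y/h₂)(1 − y/h₂) be the element bubble function of R. For every k ∈ ℕ there exists a constant c(k) > 0, independent of h₁ and h₂, such that for every real polynomial v in two variables of total degree at most k: c(k) ∫_R v² dx dy ≤ ∫_R v² b_R dx dy ≤ ∫_R v² dx dy. -/
open MeasureTheory Set

noncomputable section

/-- The open anisotropic rectangle `R = (0,h₁) × (0,h₂)`. -/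
def refRect (h₁ h₂ : ℝ) : Set (ℝ × ℝ) := Ioo 0 h₁ ×ˢ Ioo 0 h₂

/-- The element bubble function
`b_R(x,y) = 16 (x/h₁)(1 - x/h₁)(y/h₂)(1 - y/h₂)` of the rectangle `R`. -/
def bubbleR (h₁ h₂ : ℝ) (p : ℝ × ℝ) : ℝ :=
  16 * (p.1 / h₁) * (1 - p.1 / h₁) * (p.2 / h₂) * (1 - p.2 / h₂)

theorem LinearMap.BilinForm.exists_apply_self_le_mul_norm_sq {E : Type*} [NormedAddCommGroup E]
    [NormedSpace ℝ E] [FiniteDimensional ℝ E] (A : LinearMap.BilinForm ℝ E) :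
    ∃ C > 0, ∀ x, A x x ≤ C * ‖x‖ ^ 2 := by
  let A' := A.toContinuousBilinearMap
  refine ⟨‖A'‖ + 1, by positivity, fun x => ?_⟩
  have hA : A x x ≤ ‖A'‖ * ‖x‖ * ‖x‖ := (le_abs_self _).trans (A'.le_opNorm₂ x x)
  nlinarith [sq_nonneg ‖x‖]

theorem LinearMap.BilinForm.exists_mul_apply_self_le {V : Type*} [AddCommGroup V] [Module ℝ V]
    [FiniteDimensional ℝ V] (A B : LinearMap.BilinForm ℝ V)
    (hsymm : ∀ x y, B x y = B y x) (hpos : ∀ x, 0 ≤ B x x) (hdef : ∀ x, B x x = 0 → x = 0) :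
    ∃ c > 0, ∀ x, c * A x x ≤ B x x := by
  let core : InnerProductSpace.Core ℝ V :=
    { inner := fun x y => B x y
      conj_inner_symm := fun x y => hsymm y x
      re_inner_nonneg := hpos
      add_left := fun x y z => by simp
      smul_left := fun x y r => by simp
      definite := hdef }
  let N : NormedAddCommGroup V := core.toNormedAddCommGroup
  let I : InnerProductSpace ℝ V := InnerProductSpace.ofCore core.toCore
  have hB : ∀ x : V, B x x = ‖x‖ ^ 2 := fun x => real_inner_self_eq_norm_sq x
  obtain ⟨C, hC, hA⟩ := @exists_apply_self_le_mul_norm_sq V N I.toNormedSpace ‹_› A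
  refine ⟨C⁻¹, by positivity, fun x => ?_⟩
  rw [inv_mul_le_iff₀ hC, hB]
  exact hA x

theorem Continuous.integrableOn_refRect {f : ℝ × ℝ → ℝ} (hf : Continuous f) (a b : ℝ) :
    IntegrableOn f (refRect a b) :=
  (hf.continuousOn.integrableOn_compact (isCompact_Icc.prod isCompact_Icc)).mono_set
    (prod_mono Ioo_subset_Icc_self Ioo_subset_Icc_self)

theorem setIntegral_refRect_eq_mul {f : ℝ × ℝ → ℝ} (hf : Continuous f) {a b : ℝ}
    (ha : 0 < a) (hb : 0 < b) :
    ∫ p in refRect a b, f p = a * b * ∫ p in refRect 1 1, f (a * p.1, b * p.2) := by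
  have key : ∀ (g : ℝ × ℝ → ℝ) (s t : ℝ), Continuous g → 0 < s → 0 < t →
      ∫ p in refRect s t, g p = ∫ x in 0..s, ∫ y in 0..t, g (x, y) := by
    intro g s t hg hs ht
    have := hg.integrableOn_refRect s t
    simp only [intervalIntegral.integral_of_le, hs.le, ht.le, integral_Ioc_eq_integral_Ioo]
    exact setIntegral_prod g this
  rw [key f a b hf ha hb, key _ 1 1 (by fun_prop) one_pos one_pos]
  have hy : ∀ x, ∫ y in 0..b, f (x, y) = b * ∫ y in 0..1, f (x, b * y) := fun x => by
    simpa using (intervalIntegral.mul_integral_comp_mul_left (a := 0) (b := 1)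
      (f := fun y => f (x, y)) (c := b)).symm
  have hx := intervalIntegral.mul_integral_comp_mul_left (a := 0) (b := 1)
      (f := fun x => ∫ y in 0..1, f (x, b * y)) (c := a)
  simp only [mul_zero, mul_one] at hx
  simp only [hy, intervalIntegral.integral_const_mul]
  rw [← hx]
  ring

theorem continuous_bubbleR (a b : ℝ) : Continuous (bubbleR a b) := by
  unfold bubbleR
  fun_prop

theorem bubbleR_mul_mul {a b : ℝ} (ha : a ≠ 0) (hb : b ≠ 0) (p : ℝ × ℝ) :
    bubbleR a b (a * p.1, b * p.2) = bubbleR 1 1 p := by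
  simp [bubbleR, ha, hb]

theorem bubbleR_one_one_pos {p : ℝ × ℝ} (hp : p ∈ refRect 1 1) : 0 < bubbleR 1 1 p := by
  obtain ⟨⟨hx, hx'⟩, hy, hy'⟩ := hp
  have := sub_pos.2 hx'
  have := sub_pos.2 hy'
  simp only [bubbleR, div_one]
  positivity

theorem bubbleR_one_one_le_one {p : ℝ × ℝ} (hp : p ∈ refRect 1 1) : bubbleR 1 1 p ≤ 1 := by
  obtain ⟨⟨-, -⟩, hy, hy'⟩ := hp
  have h₁ : 4 * (p.1 * (1 - p.1)) ≤ 1 := by nlinarith [sq_nonneg (2 * p.1 - 1)]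
  have h₂ : 4 * (p.2 * (1 - p.2)) ≤ 1 := by nlinarith [sq_nonneg (2 * p.2 - 1)]
  have h₃ : 0 ≤ 4 * (p.2 * (1 - p.2)) := by
    have := sub_pos.2 hy'
    positivity
  calc bubbleR 1 1 p = 4 * (p.1 * (1 - p.1)) * (4 * (p.2 * (1 - p.2))) := by
        simp only [bubbleR, div_one]; ring
    _ ≤ 1 := mul_le_one₀ h₁ h₃ h₂

theorem MvPolynomial.continuous_eval_pair (v : MvPolynomial (Fin 2) ℝ) :
    Continuous fun p : ℝ × ℝ => eval ![p.1, p.2] v :=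
  v.continuous_eval.comp (by fun_prop)

theorem MvPolynomial.exists_eval_mul_eq {σ R : Type*} [Fintype σ] [CommSemiring R] (a : σ → R)
    (v : MvPolynomial σ R) :
    ∃ w : MvPolynomial σ R, w.totalDegree ≤ v.totalDegree ∧
      ∀ x : σ → R, eval x w = eval (a * x) v := by
  refine ⟨∑ s ∈ v.support, monomial s (v.coeff s * ∏ i, a i ^ s i), ?_, fun x => ?_⟩
  · exact totalDegree_finsetSum_le fun s hs =>
      (totalDegree_monomial_le _ _).trans (le_totalDegree hs)
  · rw [map_sum, eval_eq']
    refine Finset.sum_congr rfl fun s _ => ?_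
    rw [eval_monomial, Finsupp.prod_fintype _ _ fun _ => pow_zero _]
    simp only [Pi.mul_apply, mul_pow, Finset.prod_mul_distrib, mul_assoc]

/-- The weighted `L²` pairing `(u, v) ↦ ∫ u v w` of bivariate polynomials on the unit square. -/
def weightedForm (w : ℝ × ℝ → ℝ) (hw : Continuous w) :
    LinearMap.BilinForm ℝ (MvPolynomial (Fin 2) ℝ) :=
  have hint (u v : MvPolynomial (Fin 2) ℝ) : IntegrableOn (fun p : ℝ × ℝ =>
      MvPolynomial.eval ![p.1, p.2] u * MvPolynomial.eval ![p.1, p.2] v * w p) (refRect 1 1) :=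
    ((u.continuous_eval_pair.mul v.continuous_eval_pair).mul hw).integrableOn_refRect 1 1
  LinearMap.mk₂ ℝ (fun u v => ∫ p in refRect 1 1,
      MvPolynomial.eval ![p.1, p.2] u * MvPolynomial.eval ![p.1, p.2] v * w p)
    (fun u u' v => by
      rw [← integral_add (hint u v) (hint u' v)]
      simp only [map_add, add_mul])
    (fun c u v => by
      rw [smul_eq_mul, ← integral_const_mul]
      simp only [MvPolynomial.smul_eval, mul_assoc])
    (fun u v v' => by
      rw [← integral_add (hint u v) (hint u v')]
      simp only [map_add, add_mul, mul_add])
    (fun c u v => by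
      rw [smul_eq_mul, ← integral_const_mul]
      simp only [MvPolynomial.smul_eval, mul_assoc, mul_left_comm])

theorem weightedForm_apply (w : ℝ × ℝ → ℝ) (hw : Continuous w) (u v : MvPolynomial (Fin 2) ℝ) :
    weightedForm w hw u v = ∫ p in refRect 1 1,
      MvPolynomial.eval ![p.1, p.2] u * MvPolynomial.eval ![p.1, p.2] v * w p :=
  rfl

theorem weightedForm_apply_self (w : ℝ × ℝ → ℝ) (hw : Continuous w)
    (v : MvPolynomial (Fin 2) ℝ) :
    weightedForm w hw v v = ∫ p in refRect 1 1, MvPolynomial.eval ![p.1, p.2] v ^ 2 * w p := by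
  simp only [weightedForm_apply, sq]

theorem measurableSet_refRect (a b : ℝ) : MeasurableSet (refRect a b) :=
  measurableSet_Ioo.prod measurableSet_Ioo

theorem weightedForm_apply_self_nonneg {w : ℝ × ℝ → ℝ} (hw : Continuous w)
    (hpos : ∀ p ∈ refRect 1 1, 0 < w p) (v : MvPolynomial (Fin 2) ℝ) :
    0 ≤ weightedForm w hw v v := by
  rw [weightedForm_apply_self]
  exact setIntegral_nonneg (measurableSet_refRect 1 1) fun p hp =>
    mul_nonneg (sq_nonneg _) (hpos p hp).le

theorem eq_zero_of_weightedForm_apply_self_eq_zero {w : ℝ × ℝ → ℝ} (hw : Continuous w)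
    (hpos : ∀ p ∈ refRect 1 1, 0 < w p) {v : MvPolynomial (Fin 2) ℝ}
    (hv : weightedForm w hw v v = 0) : v = 0 := by
  have hcont : Continuous fun p : ℝ × ℝ => MvPolynomial.eval ![p.1, p.2] v ^ 2 * w p :=
    (v.continuous_eval_pair.pow 2).mul hw
  rw [weightedForm_apply_self, setIntegral_eq_zero_iff_of_nonneg_ae
    (ae_restrict_of_forall_mem (measurableSet_refRect 1 1) fun p hp =>
      mul_nonneg (sq_nonneg _) (hpos p hp).le) (hcont.integrableOn_refRect 1 1)] at hv
  have hzero := Measure.eqOn_open_of_ae_eq hv (isOpen_Ioo.prod isOpen_Ioo) hcont.continuousOn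
    continuousOn_const
  refine MvPolynomial.funext_set (fun _ => Ioo 0 1) (fun _ => Ioo_infinite one_pos) fun x hx => ?_
  have hmem : (x 0, x 1) ∈ refRect 1 1 := ⟨hx 0 trivial, hx 1 trivial⟩
  have hx' : ![x 0, x 1] = x := by
    ext i; fin_cases i <;> rfl
  simpa [hx', (hpos _ hmem).ne'] using hzero hmem

theorem exists_mul_integral_sq_le_integral_sq_mul_bubbleR (k : ℕ) :
    ∃ c > 0, ∀ v : MvPolynomial (Fin 2) ℝ, v.totalDegree ≤ k →
      c * (∫ p in refRect 1 1, MvPolynomial.eval ![p.1, p.2] v ^ 2)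
        ≤ ∫ p in refRect 1 1, MvPolynomial.eval ![p.1, p.2] v ^ 2 * bubbleR 1 1 p := by
  let V := MvPolynomial.restrictTotalDegree (Fin 2) ℝ k
  have hb := continuous_bubbleR 1 1
  obtain ⟨c, hc, h⟩ := LinearMap.BilinForm.exists_mul_apply_self_le
    ((weightedForm (fun _ => 1) continuous_const).restrict V)
    ((weightedForm (bubbleR 1 1) hb).restrict V)
    (fun u v => by
      simp only [LinearMap.BilinForm.restrict_apply, LinearMap.domRestrict_apply,
        weightedForm_apply, mul_comm])
    (fun v => weightedForm_apply_self_nonneg hb (fun _ => bubbleR_one_one_pos) v)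
    (fun v hv => Subtype.ext
      (eq_zero_of_weightedForm_apply_self_eq_zero hb (fun _ => bubbleR_one_one_pos) hv))
  refine ⟨c, hc, fun v hv => ?_⟩
  have := h ⟨v, (MvPolynomial.mem_restrictTotalDegree _ _ _).2 hv⟩
  simpa [weightedForm_apply_self] using this

/-- **Bubble-weighted `L²` equivalence on an anisotropic rectangle** (inequality (I1)).
For every `k` there is `c(k) > 0`, independent of `h₁` and `h₂`, such that for all
`0 < h₂ ≤ h₁` and every polynomial `v` in two variables of total degree at most `k`,
`c(k) ∫_R v² ≤ ∫_R v² b_R ≤ ∫_R v²`. -/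
theorem bubble_L2_equiv_rectangle (k : ℕ) :
    ∃ c > 0, ∀ h₁ h₂ : ℝ, 0 < h₂ → h₂ ≤ h₁ →
      ∀ v : MvPolynomial (Fin 2) ℝ, v.totalDegree ≤ k →
        c * (∫ p in refRect h₁ h₂, (MvPolynomial.eval ![p.1, p.2] v) ^ 2)
            ≤ (∫ p in refRect h₁ h₂,
                (MvPolynomial.eval ![p.1, p.2] v) ^ 2 * bubbleR h₁ h₂ p)
          ∧ (∫ p in refRect h₁ h₂,
                (MvPolynomial.eval ![p.1, p.2] v) ^ 2 * bubbleR h₁ h₂ p)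
            ≤ ∫ p in refRect h₁ h₂, (MvPolynomial.eval ![p.1, p.2] v) ^ 2 := by
  obtain ⟨c, hc, hlower⟩ := exists_mul_integral_sq_le_integral_sq_mul_bubbleR k
  refine ⟨c, hc, fun h₁ h₂ hh₂ hle v hv => ?_⟩
  have hh₁ : 0 < h₁ := hh₂.trans_le hle
  obtain ⟨w, hwdeg, hw⟩ := v.exists_eval_mul_eq ![h₁, h₂]
  have heval (p : ℝ × ℝ) :
      MvPolynomial.eval ![h₁ * p.1, h₂ * p.2] v = MvPolynomial.eval ![p.1, p.2] w := by
    rw [hw]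
    congr 2
    ext i; fin_cases i <;> rfl
  have hsq (u : MvPolynomial (Fin 2) ℝ) :
      Continuous fun p : ℝ × ℝ => MvPolynomial.eval ![p.1, p.2] u ^ 2 :=
    u.continuous_eval_pair.pow 2
  have hsqb (u : MvPolynomial (Fin 2) ℝ) (a b : ℝ) : Continuous fun p : ℝ × ℝ =>
      MvPolynomial.eval ![p.1, p.2] u ^ 2 * bubbleR a b p :=
    (hsq u).mul (continuous_bubbleR a b)
  rw [setIntegral_refRect_eq_mul (hsq v) hh₁ hh₂,
    setIntegral_refRect_eq_mul (hsqb v h₁ h₂) hh₁ hh₂]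
  simp only [heval, bubbleR_mul_mul hh₁.ne' hh₂.ne']
  constructor
  · rw [mul_left_comm]
    gcongr
    exact hlower w (hwdeg.trans hv)
  · refine mul_le_mul_of_nonneg_left ?_ (by positivity)
    exact setIntegral_mono_on ((hsqb w 1 1).integrableOn_refRect 1 1)
      ((hsq w).integrableOn_refRect 1 1) (measurableSet_refRect 1 1) fun p hp =>
        mul_le_of_le_one_right (sq_nonneg _) (bubbleR_one_one_le_one hp)

end
end

section
/- Let K̄ = (0,1)² with edges Ē₁ = (0,1)×{0}, Ē₂ = (0,1)×{1}, Ē₃ = {0}×(0,1), Ē₄ = {1}×(0,1), and let ℙ² denote the six-dimensional space of real polynomials in two variables of total degree at most 2. Define the functionals θ̄ᵢ(q) := ∫_{Ēᵢ} q ds for i = 1,…,4, θ̄₅(q) := ∫_{K̄} 3(2x−1)(2y−1) q(x,y) dx dy, and θ̄₆(q) := ∫_{K̄} q(x,y) dx dy. Then the linear map ℙ² → ℝ⁶, q ↦ (θ̄₁(q), …, θ̄₆(q)), is a linear isomorphism; equivalently, the triplet (K̄, ℙ², {θ̄ᵢ}ᵢ₌₁⁶) is a finite element. -/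
open MeasureTheory Set

noncomputable section

/-- The quadratic polynomial `q(x,y) = a₀ + a₁ x + a₂ y + a₃ x² + a₄ x y + a₅ y²` of
the six-dimensional space `ℙ²` with coefficient vector `a`. -/
def p2Poly (a : Fin 6 → ℝ) (p : ℝ × ℝ) : ℝ :=
  a 0 + a 1 * p.1 + a 2 * p.2 + a 3 * p.1 ^ 2 + a 4 * (p.1 * p.2) + a 5 * p.2 ^ 2

/-- The six degrees of freedom of the Crouzeix–Raviart element of type III on the
reference square `K̄ = (0,1)²`: the integrals over the four edges `Ē₁ = (0,1)×{0}`,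
`Ē₂ = (0,1)×{1}`, `Ē₃ = {0}×(0,1)`, `Ē₄ = {1}×(0,1)`, the weighted volume moment
against `3(2x-1)(2y-1)`, and the volume integral. -/
def p2Dof (a : Fin 6 → ℝ) : Fin 6 → ℝ :=
  ![∫ x in Ioo (0 : ℝ) 1, p2Poly a (x, 0),
    ∫ x in Ioo (0 : ℝ) 1, p2Poly a (x, 1),
    ∫ y in Ioo (0 : ℝ) 1, p2Poly a (0, y),
    ∫ y in Ioo (0 : ℝ) 1, p2Poly a (1, y),
    ∫ p in Ioo (0 : ℝ) 1 ×ˢ Ioo (0 : ℝ) 1, 3 * (2 * p.1 - 1) * (2 * p.2 - 1) * p2Poly a p,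
    ∫ p in Ioo (0 : ℝ) 1 ×ˢ Ioo (0 : ℝ) 1, p2Poly a p]

/-- The integral of a cubic polynomial over the unit interval. -/
theorem integral_Ioo_cubic (c₀ c₁ c₂ c₃ : ℝ) {f : ℝ → ℝ}
    (hf : ∀ x, f x = c₀ + c₁ * x + c₂ * x ^ 2 + c₃ * x ^ 3) :
    ∫ x in Ioo (0 : ℝ) 1, f x = c₀ + c₁ / 2 + c₂ / 3 + c₃ / 4 := by
  simp only [hf]
  rw [← integral_Ioc_eq_integral_Ioo, ← intervalIntegral.integral_of_le zero_le_one,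
    intervalIntegral.integral_add, intervalIntegral.integral_add, intervalIntegral.integral_add,
    intervalIntegral.integral_const_mul c₁ fun x => x]
  · simp only [intervalIntegral.integral_const, intervalIntegral.integral_const_mul, integral_id,
      integral_pow, smul_eq_mul]
    norm_num
    ring
  all_goals exact Continuous.intervalIntegrable (by fun_prop) _ _

/-- A continuous function on the unit square is integrated by iterated integration. -/
theorem integral_unit_square {f : ℝ × ℝ → ℝ} (hf : Continuous f) :
    ∫ p in Ioo (0 : ℝ) 1 ×ˢ Ioo (0 : ℝ) 1, f p =
      ∫ x in Ioo (0 : ℝ) 1, ∫ y in Ioo (0 : ℝ) 1, f (x, y) := by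
  rw [Measure.volume_eq_prod]
  refine setIntegral_prod f ?_
  rw [← Measure.volume_eq_prod]
  exact (hf.continuousOn.integrableOn_compact (isCompact_Icc.prod isCompact_Icc)).mono_set
    (prod_mono Ioo_subset_Icc_self Ioo_subset_Icc_self)

theorem continuous_p2Poly (a : Fin 6 → ℝ) : Continuous (p2Poly a) := by
  unfold p2Poly
  fun_prop

theorem integral_p2Poly_bottom (a : Fin 6 → ℝ) :
    ∫ x in Ioo (0 : ℝ) 1, p2Poly a (x, 0) = a 0 + a 1 / 2 + a 3 / 3 := by
  rw [integral_Ioo_cubic (a 0) (a 1) (a 3) 0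
    fun _ => by simp only [p2Poly]; ring]
  ring

theorem integral_p2Poly_top (a : Fin 6 → ℝ) :
    ∫ x in Ioo (0 : ℝ) 1, p2Poly a (x, 1) =
      a 0 + a 2 + a 5 + (a 1 + a 4) / 2 + a 3 / 3 := by
  rw [integral_Ioo_cubic (a 0 + a 2 + a 5) (a 1 + a 4) (a 3) 0
    fun _ => by simp only [p2Poly]; ring]
  ring

theorem integral_p2Poly_left (a : Fin 6 → ℝ) :
    ∫ y in Ioo (0 : ℝ) 1, p2Poly a (0, y) = a 0 + a 2 / 2 + a 5 / 3 := by
  rw [integral_Ioo_cubic (a 0) (a 2) (a 5) 0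
    fun _ => by simp only [p2Poly]; ring]
  ring

theorem integral_p2Poly_right (a : Fin 6 → ℝ) :
    ∫ y in Ioo (0 : ℝ) 1, p2Poly a (1, y) =
      a 0 + a 1 + a 3 + (a 2 + a 4) / 2 + a 5 / 3 := by
  rw [integral_Ioo_cubic (a 0 + a 1 + a 3) (a 2 + a 4) (a 5) 0
    fun _ => by simp only [p2Poly]; ring]
  ring

theorem integral_p2Poly_vertical (a : Fin 6 → ℝ) (x : ℝ) :
    ∫ y in Ioo (0 : ℝ) 1, p2Poly a (x, y) =
      a 0 + a 2 / 2 + a 5 / 3 + (a 1 + a 4 / 2) * x + a 3 * x ^ 2 := by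
  rw [integral_Ioo_cubic (a 0 + a 1 * x + a 3 * x ^ 2) (a 2 + a 4 * x) (a 5) 0
    fun _ => by simp only [p2Poly]; ring]
  ring

theorem integral_weighted_p2Poly_vertical (a : Fin 6 → ℝ) (x : ℝ) :
    ∫ y in Ioo (0 : ℝ) 1, 3 * (2 * x - 1) * (2 * y - 1) * p2Poly a (x, y) =
      (2 * x - 1) * (a 2 + a 4 * x + a 5) / 2 := by
  rw [integral_Ioo_cubic (-(3 * (2 * x - 1) * (a 0 + a 1 * x + a 3 * x ^ 2)))
    (3 * (2 * x - 1) * (2 * (a 0 + a 1 * x + a 3 * x ^ 2) - (a 2 + a 4 * x)))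
    (3 * (2 * x - 1) * (2 * (a 2 + a 4 * x) - a 5)) (3 * (2 * x - 1) * (2 * a 5))
    fun _ => by simp only [p2Poly]; ring]
  ring

theorem integral_p2Poly_square (a : Fin 6 → ℝ) :
    ∫ p in Ioo (0 : ℝ) 1 ×ˢ Ioo (0 : ℝ) 1, p2Poly a p =
      a 0 + a 1 / 2 + a 2 / 2 + a 3 / 3 + a 4 / 4 + a 5 / 3 := by
  rw [integral_unit_square (continuous_p2Poly a)]
  simp only [integral_p2Poly_vertical]
  rw [integral_Ioo_cubic (a 0 + a 2 / 2 + a 5 / 3) (a 1 + a 4 / 2) (a 3) 0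
    fun _ => by ring]
  ring

theorem integral_weighted_p2Poly_square (a : Fin 6 → ℝ) :
    ∫ p in Ioo (0 : ℝ) 1 ×ˢ Ioo (0 : ℝ) 1, 3 * (2 * p.1 - 1) * (2 * p.2 - 1) * p2Poly a p =
      a 4 / 12 := by
  have := continuous_p2Poly a
  rw [integral_unit_square (by fun_prop)]
  simp only [integral_weighted_p2Poly_vertical]
  rw [integral_Ioo_cubic (-(a 2 + a 5) / 2) (a 2 + a 5 - a 4 / 2) (a 4) 0
    fun _ => by ring]
  ring

theorem p2Dof_eq (a : Fin 6 → ℝ) :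
    p2Dof a =
      ![a 0 + a 1 / 2 + a 3 / 3,
        a 0 + a 2 + a 5 + (a 1 + a 4) / 2 + a 3 / 3,
        a 0 + a 2 / 2 + a 5 / 3,
        a 0 + a 1 + a 3 + (a 2 + a 4) / 2 + a 5 / 3,
        a 4 / 12,
        a 0 + a 1 / 2 + a 2 / 2 + a 3 / 3 + a 4 / 4 + a 5 / 3] := by
  rw [p2Dof, integral_p2Poly_bottom, integral_p2Poly_top, integral_p2Poly_left,
    integral_p2Poly_right, integral_weighted_p2Poly_square, integral_p2Poly_square]

/-- The coefficients of the quadratic polynomial with prescribed degrees of freedom. -/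
def p2OfDof (b : Fin 6 → ℝ) : Fin 6 → ℝ :=
  ![b 0 + b 2 + 3 * b 4 - b 5,
    -4 * b 2 - 2 * b 3 - 6 * b 4 + 6 * b 5,
    -4 * b 0 - 2 * b 1 - 6 * b 4 + 6 * b 5,
    3 * b 2 + 3 * b 3 - 6 * b 5,
    12 * b 4,
    3 * b 0 + 3 * b 1 - 6 * b 5]

theorem p2OfDof_p2Dof (a : Fin 6 → ℝ) : p2OfDof (p2Dof a) = a := by
  rw [p2Dof_eq]
  ext i
  fin_cases i <;> simp [p2OfDof] <;> ring

theorem p2Dof_p2OfDof (b : Fin 6 → ℝ) : p2Dof (p2OfDof b) = b := by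
  rw [p2Dof_eq]
  ext i
  fin_cases i <;> simp [p2OfDof] <;> ring

/-- **Unisolvence of the Crouzeix–Raviart element of type III.**  The linear map from
the six-dimensional space `ℙ²` of polynomials of total degree at most two
(parametrised by its coefficients) to `ℝ⁶` given by the four edge integrals, the
weighted volume moment `θ̄₅`, and the volume integral `θ̄₆` is a linear isomorphism;
equivalently, the triplet `(K̄, ℙ², {θ̄ᵢ}ᵢ₌₁⁶)` is a finite element. -/
theorem p2_square_unisolvent : Function.Bijective p2Dof :=
  Function.bijective_iff_has_inverse.mpr ⟨p2OfDof, p2OfDof_p2Dof, p2Dof_p2OfDof⟩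

end
end
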